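/- For all integers 1 ≤ K ≤ D and every C ≥ 1, the induced regularizer w ↦ R_{K,C}(w) is a norm on ℝ^D: R_{K,C}(w) is finite and nonnegative for every w ∈ ℝ^D; R_{K,C}(w) = 0 if and only if w = 0; R_{K,C}(γ·w) = |γ|·R_{K,C}(w) for every γ ∈ ℝ and w ∈ ℝ^D; and R_{K,C}(w₁ + w₂) ≤ R_{K,C}(w₁) + R_{K,C}(w₂) for all w₁, w₂ ∈ ℝ^D. -/

import Mathlib

open scoped BigOperators

/-- Circular convolution of `u ∈ ℝ^K` with `v ∈ ℝ^D`:
`(u⋆v)[d] = (1/√D)·Σ_{k=0}^{K-1} u[k]·v[(d+k) mod D]`. -/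
noncomputable def circConv {K D : ℕ} (u : Fin K → ℝ) (v : Fin D → ℝ) : Fin D → ℝ :=
  fun d => (1 / Real.sqrt D) * ∑ k : Fin K, u k * v ⟨((d : ℕ) + (k : ℕ)) % D, Nat.mod_lt _ d.pos⟩

/-- Flip of a vector: `z↓[d] = z[D-1-d]`. -/
def flipVec {D : ℕ} (z : Fin D → ℝ) : Fin D → ℝ :=
  fun d => z ⟨D - 1 - (d : ℕ), by have := d.isLt; omega⟩

/-- Linear predictor realized by a two-layer linear convolutional network with
kernel size `K` and `C` output channels: `w(U,V) = Σ_c (U[:,c] ⋆ (V[:,c])↓)↓`. -/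
noncomputable def predictor {K D C : ℕ} (U : Fin K → Fin C → ℝ) (V : Fin D → Fin C → ℝ) :
    Fin D → ℝ :=
  fun d => ∑ c : Fin C, flipVec (circConv (fun k => U k c) (flipVec (fun l => V l c))) d

/-- The induced regularizer
`R_{K,C}(w) = inf { ‖U‖_F² + ‖V‖_F² : w(U,V) = w }`. -/
noncomputable def inducedReg (K D C : ℕ) (w : Fin D → ℝ) : ℝ :=
  sInf { t : ℝ | ∃ (U : Fin K → Fin C → ℝ) (V : Fin D → Fin C → ℝ),
    predictor U V = w ∧ t = (∑ k, ∑ c, (U k c) ^ 2) + ∑ l, ∑ c, (V l c) ^ 2 }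

/-- Discrete Fourier transform: `ŵ[d] = (1/√D)·Σ_l w[l]·exp(-2πi·d·l/D)`. -/
noncomputable def dft {D : ℕ} (w : Fin D → ℝ) : Fin D → ℂ :=
  fun d => (1 / (Real.sqrt D : ℂ)) * ∑ l : Fin D, (w l : ℂ) *
    Complex.exp (-((2 : ℂ) * (Real.pi : ℂ) * Complex.I * ((d : ℕ) : ℂ) * ((l : ℕ) : ℂ)) / (D : ℂ))

theorem flipVec_flipVec {D : ℕ} (z : Fin D → ℝ) : flipVec (flipVec z) = z := by
  funext d
  simp only [flipVec]
  congr 1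
  apply Fin.ext
  have := d.isLt
  simp only
  omega

theorem flipVec_sum {D : ℕ} {ι : Type*} (s : Finset ι) (f : ι → Fin D → ℝ) :
    flipVec (∑ i ∈ s, f i) = ∑ i ∈ s, flipVec (f i) := by
  funext d
  simp [flipVec, Finset.sum_apply]

theorem sum_flipVec_sq {D : ℕ} (z : Fin D → ℝ) : ∑ l, flipVec z l ^ 2 = ∑ l, z l ^ 2 :=
  Equiv.sum_comp Fin.revPerm (fun l => z l ^ 2) ▸ Finset.sum_congr rfl fun l _ => by
    simp only [flipVec, Fin.revPerm_apply]
    congr 2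
    apply Fin.ext
    simp only [Fin.val_rev]
    omega

theorem circConv_smul_smul {K D : ℕ} (a b : ℝ) (u : Fin K → ℝ) (z : Fin D → ℝ) :
    circConv (a • u) (b • z) = (a * b) • circConv u z := by
  funext d
  simp only [circConv, Pi.smul_apply, smul_eq_mul, Finset.mul_sum]
  exact Finset.sum_congr rfl fun k _ => by ring

theorem zero_circConv {K D : ℕ} (z : Fin D → ℝ) : circConv (0 : Fin K → ℝ) z = 0 := by
  funext d
  simp [circConv]

theorem circConv_rotate {K D : ℕ} {c s : ℝ} (h : c ^ 2 + s ^ 2 = 1) (u₁ u₂ : Fin K → ℝ)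
    (z₁ z₂ : Fin D → ℝ) :
    circConv (c • u₁ + s • u₂) (c • z₁ + s • z₂) +
      circConv (c • u₂ - s • u₁) (c • z₂ - s • z₁) = circConv u₁ z₁ + circConv u₂ z₂ := by
  funext d
  simp only [circConv, Pi.add_apply, Pi.sub_apply, Pi.smul_apply, smul_eq_mul, ← mul_add,
    ← Finset.sum_add_distrib]
  congr 1
  refine Finset.sum_congr rfl fun k _ => ?_
  linear_combination (u₁ k * z₁ ⟨(d + k) % D, Nat.mod_lt _ d.pos⟩ +
    u₂ k * z₂ ⟨(d + k) % D, Nat.mod_lt _ d.pos⟩) * h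

theorem sum_sq_rotate {n : ℕ} {c s : ℝ} (h : c ^ 2 + s ^ 2 = 1) (x y : Fin n → ℝ) :
    ∑ i, (c • x + s • y) i ^ 2 + ∑ i, (c • y - s • x) i ^ 2 = ∑ i, x i ^ 2 + ∑ i, y i ^ 2 := by
  simp only [← Finset.sum_add_distrib, Pi.add_apply, Pi.sub_apply, Pi.smul_apply, smul_eq_mul]
  exact Finset.sum_congr rfl fun i _ => by linear_combination (x i ^ 2 + y i ^ 2) * h

theorem exists_rotation (a b : ℝ) : ∃ c s : ℝ, c ^ 2 + s ^ 2 = 1 ∧ c * b - s * a = 0 := by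
  by_cases h : a ^ 2 + b ^ 2 = 0
  · exact ⟨1, 0, by norm_num, by nlinarith [sq_nonneg a, sq_nonneg b]⟩
  · have hpos : 0 < a ^ 2 + b ^ 2 := lt_of_le_of_ne (by positivity) (Ne.symm h)
    have hs := Real.sq_sqrt hpos.le
    have hne : √(a ^ 2 + b ^ 2) ≠ 0 := (Real.sqrt_pos.2 hpos).ne'
    refine ⟨a / √(a ^ 2 + b ^ 2), b / √(a ^ 2 + b ^ 2), ?_, by ring⟩
    rw [div_pow, div_pow, hs, ← add_div, div_self h]

/-- The sum of a function on `Fin K` vanishing below `j` is unchanged by shifting it down by `j`. -/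
theorem sum_shift_eq {K : ℕ} (j : ℕ) (f : Fin K → ℝ) (hf : ∀ i : Fin K, (i : ℕ) < j → f i = 0) :
    ∑ k : Fin K, (if h : (k : ℕ) + j < K then f ⟨k + j, h⟩ else 0) = ∑ k, f k := by
  set g : ℕ → ℝ := fun n => if h : n < K then f ⟨n, h⟩ else 0 with hg
  have h₁ : ∑ k, f k = ∑ n ∈ Finset.range K, g n := by
    rw [← Fin.sum_univ_eq_sum_range]
    exact Finset.sum_congr rfl fun k _ => by simp [hg]
  have h₂ : ∑ k : Fin K, (if h : (k : ℕ) + j < K then f ⟨k + j, h⟩ else 0) =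
      ∑ n ∈ Finset.range K, g (j + n) := by
    rw [← Fin.sum_univ_eq_sum_range (fun n => g (j + n))]
    exact Finset.sum_congr rfl fun k _ => by simp only [hg, add_comm j]
  have h₃ : ∑ n ∈ Finset.range j, g n = 0 := Finset.sum_eq_zero fun n hn => by
    simp only [hg]
    split_ifs with h
    · exact hf _ (Finset.mem_range.1 hn)
    · rfl
  have h₄ : ∑ n ∈ Finset.range j, g (K + n) = 0 := Finset.sum_eq_zero fun n _ => by simp [hg]
  rw [h₁, h₂]
  have h₅ := Finset.sum_range_add g j K
  rw [add_comm j K, Finset.sum_range_add g K j] at h₅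
  linarith

/-- Leading zeros of the kernel can be shifted away, by rotating the other factor. -/
theorem exists_circConv_shift {K D : ℕ} (hK : 0 < K) (u : Fin K → ℝ) (z : Fin D → ℝ)
    (hu : u ≠ 0) :
    ∃ (u' : Fin K → ℝ) (z' : Fin D → ℝ), u' ⟨0, hK⟩ ≠ 0 ∧ circConv u' z' = circConv u z ∧
      ∑ k, u' k ^ 2 = ∑ k, u k ^ 2 ∧ ∑ l, z' l ^ 2 = ∑ l, z l ^ 2 := by
  have hex : ∃ n, ∃ h : n < K, u ⟨n, h⟩ ≠ 0 := by
    obtain ⟨i, hi⟩ := Function.ne_iff.1 hu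
    exact ⟨i, i.isLt, hi⟩
  classical
  obtain ⟨j, ⟨hj, huj⟩, hmin⟩ : ∃ j, (∃ h : j < K, u ⟨j, h⟩ ≠ 0) ∧
      ∀ i : Fin K, (i : ℕ) < j → u i = 0 :=
    ⟨Nat.find hex, Nat.find_spec hex, fun i hi => by
      by_contra h
      exact Nat.find_min hex hi ⟨i.isLt, h⟩⟩
  refine ⟨fun k => if h : (k : ℕ) + j < K then u ⟨k + j, h⟩ else 0,
    fun l => z ⟨(l + j) % D, Nat.mod_lt _ l.pos⟩, ?_, ?_, ?_, ?_⟩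
  · simpa [hj] using huj
  · funext d
    simp only [circConv]
    congr 1
    rw [← sum_shift_eq j (fun k => u k * z ⟨(d + k) % D, Nat.mod_lt _ d.pos⟩)
      fun i hi => by simp [hmin i hi]]
    refine Finset.sum_congr rfl fun k _ => ?_
    split_ifs
    · simp [add_assoc]
    · simp
  · rw [← sum_shift_eq j (fun k => u k ^ 2) fun i hi => by simp [hmin i hi]]
    refine Finset.sum_congr rfl fun k _ => ?_
    by_cases h : (k : ℕ) + j < K <;> simp [h]
  · rcases Nat.eq_zero_or_pos D with rfl | hD
    · simp
    · have : NeZero D := ⟨hD.ne'⟩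
      rw [← Equiv.sum_comp (Equiv.addRight (Fin.ofNat D j)) (fun l => z l ^ 2)]
      refine Finset.sum_congr rfl fun l _ => ?_
      refine congrArg (fun i => z i ^ 2) (Fin.ext ?_)
      simp [Fin.val_add]

theorem continuous_circConv {K D : ℕ} {X : Type*} [TopologicalSpace X] {f : X → Fin K → ℝ}
    {g : X → Fin D → ℝ} (hf : Continuous f) (hg : Continuous g) :
    Continuous fun x => circConv (f x) (g x) := by
  unfold circConv
  fun_prop

theorem norm_le_of_sum_sq_le {n : ℕ} {t : ℝ} {x : Fin n → ℝ} (h : ∑ i, x i ^ 2 ≤ t) :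
    ‖x‖ ≤ √t := by
  refine (pi_norm_le_iff_of_nonneg (Real.sqrt_nonneg t)).2 fun i => Real.abs_le_sqrt ?_
  exact (Finset.single_le_sum (f := fun i => x i ^ 2) (fun i _ => sq_nonneg _)
    (Finset.mem_univ i)).trans h

/-- Two channels can be merged into one without increasing the cost: among all two-channel
realizations of bounded cost, one whose kernels have maximal energy in their first entries is, up
to a rotation of the channels, supported on a single channel. -/
theorem exists_circConv_eq_add {K D : ℕ} (hK : 0 < K) (u₁ u₂ : Fin K → ℝ) (z₁ z₂ : Fin D → ℝ) :
    ∃ (u : Fin K → ℝ) (z : Fin D → ℝ), circConv u z = circConv u₁ z₁ + circConv u₂ z₂ ∧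
      ∑ k, u k ^ 2 + ∑ l, z l ^ 2 ≤
        (∑ k, u₁ k ^ 2 + ∑ l, z₁ l ^ 2) + (∑ k, u₂ k ^ 2 + ∑ l, z₂ l ^ 2) := by
  set t := (∑ k, u₁ k ^ 2 + ∑ l, z₁ l ^ 2) + (∑ k, u₂ k ^ 2 + ∑ l, z₂ l ^ 2)
  set w := circConv u₁ z₁ + circConv u₂ z₂
  let S : Set (((Fin K → ℝ) × (Fin D → ℝ)) × ((Fin K → ℝ) × (Fin D → ℝ))) :=
    {p | circConv p.1.1 p.1.2 + circConv p.2.1 p.2.2 = w ∧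
      (∑ k, p.1.1 k ^ 2 + ∑ l, p.1.2 l ^ 2) + (∑ k, p.2.1 k ^ 2 + ∑ l, p.2.2 l ^ 2) ≤ t}
  have hclosed : IsClosed S := by
    refine (isClosed_eq ?_ continuous_const).and (isClosed_le ?_ continuous_const)
    · exact (continuous_circConv (by fun_prop) (by fun_prop)).add
        (continuous_circConv (by fun_prop) (by fun_prop))
    · fun_prop
  have hbdd : Bornology.IsBounded S := by
    refine isBounded_iff_forall_norm_le.2 ⟨√t, ?_⟩
    rintro ⟨⟨a, b⟩, c, d⟩ ⟨-, h⟩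
    simp only at h
    have ha : 0 ≤ ∑ k, a k ^ 2 := Finset.sum_nonneg fun _ _ => sq_nonneg _
    have hb : 0 ≤ ∑ k, b k ^ 2 := Finset.sum_nonneg fun _ _ => sq_nonneg _
    have hc : 0 ≤ ∑ k, c k ^ 2 := Finset.sum_nonneg fun _ _ => sq_nonneg _
    have hd : 0 ≤ ∑ k, d k ^ 2 := Finset.sum_nonneg fun _ _ => sq_nonneg _
    simp only [Prod.norm_def, sup_le_iff]
    refine ⟨⟨?_, ?_⟩, ?_, ?_⟩ <;> exact norm_le_of_sum_sq_le (by linarith)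
  have hne : S.Nonempty := ⟨((u₁, z₁), (u₂, z₂)), rfl, le_rfl⟩
  obtain ⟨⟨⟨a, x⟩, b, y⟩, ⟨hpw, hpt⟩, hmax⟩ :=
    (Metric.isCompact_of_isClosed_isBounded hclosed hbdd).exists_isMaxOn hne
      (f := fun p => p.1.1 ⟨0, hK⟩ ^ 2 + p.2.1 ⟨0, hK⟩ ^ 2) (by fun_prop)
  simp only at hpw hpt
  obtain ⟨c, s, hcs, h₀⟩ := exists_rotation (a ⟨0, hK⟩) (b ⟨0, hK⟩)
  have hconv := circConv_rotate hcs a b x y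
  have hu := sum_sq_rotate hcs a b
  have hz := sum_sq_rotate hcs x y
  by_cases hzero : c • b - s • a = 0
  · refine ⟨c • a + s • b, c • x + s • y, ?_, ?_⟩
    · rw [← hpw, ← hconv, hzero, zero_circConv, add_zero]
    · have h₁ : 0 ≤ ∑ k, (c • b - s • a) k ^ 2 := Finset.sum_nonneg fun _ _ => sq_nonneg _
      have h₂ : 0 ≤ ∑ k, (c • y - s • x) k ^ 2 := Finset.sum_nonneg fun _ _ => sq_nonneg _
      linarith
  · obtain ⟨b', y', hb', hconv', hub', hzy'⟩ :=
      exists_circConv_shift hK _ (c • y - s • x) hzero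
    have hmem : ((c • a + s • b, c • x + s • y), (b', y')) ∈ S := by
      refine ⟨?_, ?_⟩
      · simp only [hconv', hconv, hpw]
      · simp only [hub', hzy']
        linarith
    have hle : (c • a + s • b) ⟨0, hK⟩ ^ 2 + b' ⟨0, hK⟩ ^ 2 ≤
        a ⟨0, hK⟩ ^ 2 + b ⟨0, hK⟩ ^ 2 := hmax hmem
    have hpos : 0 < b' ⟨0, hK⟩ ^ 2 := by positivity
    simp only [Pi.add_apply, Pi.smul_apply, smul_eq_mul] at hle
    have hrot : (c * a ⟨0, hK⟩ + s * b ⟨0, hK⟩) ^ 2 = a ⟨0, hK⟩ ^ 2 + b ⟨0, hK⟩ ^ 2 := by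
      linear_combination (a ⟨0, hK⟩ ^ 2 + b ⟨0, hK⟩ ^ 2) * hcs -
        (c * b ⟨0, hK⟩ - s * a ⟨0, hK⟩) * h₀
    linarith

theorem exists_circConv_eq_sum {K D : ℕ} {ι : Type*} (hK : 0 < K) (s : Finset ι)
    (u : ι → Fin K → ℝ) (z : ι → Fin D → ℝ) :
    ∃ (u' : Fin K → ℝ) (z' : Fin D → ℝ), circConv u' z' = ∑ c ∈ s, circConv (u c) (z c) ∧
      ∑ k, u' k ^ 2 + ∑ l, z' l ^ 2 ≤ ∑ c ∈ s, (∑ k, u c k ^ 2 + ∑ l, z c l ^ 2) := by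
  classical
  induction s using Finset.induction_on with
  | empty => exact ⟨0, 0, by simp [zero_circConv], by simp⟩
  | insert c s hc ih =>
    obtain ⟨u', z', h, hle⟩ := ih
    obtain ⟨u'', z'', h', hle'⟩ := exists_circConv_eq_add hK (u c) u' (z c) z'
    refine ⟨u'', z'', ?_, ?_⟩
    · rw [Finset.sum_insert hc, h', h]
    · rw [Finset.sum_insert hc]
      linarith

theorem abs_circConv_le {K D : ℕ} (u : Fin K → ℝ) (z : Fin D → ℝ) (d : Fin D) :
    |circConv u z d| ≤ K * (∑ k, u k ^ 2 + ∑ l, z l ^ 2) := by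
  have hD : 1 / √(D : ℝ) ≤ 1 := by
    have : (1 : ℝ) ≤ D := by exact_mod_cast d.pos
    exact div_le_one_of_le₀ (Real.one_le_sqrt.2 this) (Real.sqrt_nonneg _)
  have hterm : ∀ k l, |u k * z l| ≤ ∑ k, u k ^ 2 + ∑ l, z l ^ 2 := fun k l => by
    have h₁ := Finset.single_le_sum (f := fun k => u k ^ 2) (fun i _ => sq_nonneg _)
      (Finset.mem_univ k)
    have h₂ := Finset.single_le_sum (f := fun l => z l ^ 2) (fun i _ => sq_nonneg _)
      (Finset.mem_univ l)
    rw [abs_le]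
    constructor <;> nlinarith [sq_nonneg (u k + z l), sq_nonneg (u k - z l)]
  rw [circConv, abs_mul, abs_of_nonneg (by positivity)]
  refine (mul_le_of_le_one_left (abs_nonneg _) hD).trans
    ((Finset.abs_sum_le_sum_abs _ _).trans ((Finset.sum_le_sum fun k _ => hterm k _).trans ?_))
  simp [mul_add]

theorem predictor_eq_flipVec_sum {K D C : ℕ} (U : Fin K → Fin C → ℝ) (V : Fin D → Fin C → ℝ) :
    predictor U V = flipVec (∑ c, circConv (fun k => U k c) (flipVec fun l => V l c)) := by
  funext d
  simp [predictor, flipVec_sum, Finset.sum_apply]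

theorem inducedReg_flipVec_circConv_le {K D C : ℕ} (hC : 1 ≤ C) (u : Fin K → ℝ)
    (z : Fin D → ℝ) :
    inducedReg K D C (flipVec (circConv u z)) ≤ ∑ k, u k ^ 2 + ∑ l, z l ^ 2 := by
  refine csInf_le ⟨0, ?_⟩ ?_
  · rintro _ ⟨U, V, -, rfl⟩
    positivity
  · refine ⟨fun k c => if c = ⟨0, hC⟩ then u k else 0,
      fun l c => if c = ⟨0, hC⟩ then flipVec z l else 0, ?_, ?_⟩
    · rw [predictor_eq_flipVec_sum, Finset.sum_eq_single ⟨0, hC⟩]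
      · simp only [if_true, flipVec_flipVec]
      · intro c _ hc
        simp only [hc, if_false]
        exact zero_circConv _
      · simp
    · simp [ite_pow, sum_flipVec_sq]

/-- A single channel suffices to bound the induced regularizer from below. -/
theorem le_inducedReg {K D C : ℕ} (hK : 1 ≤ K) (hC : 1 ≤ C) {w : Fin D → ℝ} {r : ℝ}
    (h : ∀ (u : Fin K → ℝ) (z : Fin D → ℝ), flipVec (circConv u z) = w →
      r ≤ ∑ k, u k ^ 2 + ∑ l, z l ^ 2) :
    r ≤ inducedReg K D C w := by
  refine le_csInf ?_ ?_
  · refine ⟨_, fun k c => if c = ⟨0, hC⟩ then (if k = ⟨0, hK⟩ then 1 else 0) else 0,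
      fun l c => √D * w l, ?_, rfl⟩
    rw [predictor_eq_flipVec_sum, Finset.sum_eq_single ⟨0, hC⟩]
    · refine Eq.trans (congrArg flipVec ?_) (flipVec_flipVec w)
      funext d
      have hD : √(D : ℝ) ≠ 0 := (Real.sqrt_pos.2 (by exact_mod_cast d.pos)).ne'
      simp [circConv, flipVec, Nat.mod_eq_of_lt d.isLt, hD]
    · intro c _ hc
      simp only [hc, if_false]
      exact zero_circConv _
    · simp
  · rintro _ ⟨U, V, hw, rfl⟩
    obtain ⟨u, z, huz, hle⟩ := exists_circConv_eq_sum hK Finset.univ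
      (fun c k => U k c) (fun c => flipVec fun l => V l c)
    refine (h u z ?_).trans (hle.trans_eq ?_)
    · rw [huz, ← hw, predictor_eq_flipVec_sum]
    · simp only [sum_flipVec_sq, Finset.sum_add_distrib]
      congr 1 <;> exact Finset.sum_comm

theorem inducedReg_nonneg {K D C : ℕ} (w : Fin D → ℝ) : 0 ≤ inducedReg K D C w := by
  refine Real.sInf_nonneg ?_
  rintro _ ⟨U, V, -, rfl⟩
  positivity

theorem inducedReg_zero {K D C : ℕ} (hC : 1 ≤ C) : inducedReg K D C 0 = 0 := by
  refine le_antisymm ?_ (inducedReg_nonneg _)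
  have h := inducedReg_flipVec_circConv_le (D := D) hC (0 : Fin K → ℝ) 0
  rw [zero_circConv] at h
  exact h.trans_eq (by simp)

theorem inducedReg_smul_le {K D C : ℕ} (hK : 1 ≤ K) (hC : 1 ≤ C) {γ : ℝ} (hγ : γ ≠ 0)
    (w : Fin D → ℝ) : inducedReg K D C (γ • w) ≤ |γ| * inducedReg K D C w := by
  have hpos : 0 < |γ| := abs_pos.2 hγ
  have hsq : √|γ| ^ 2 = |γ| := Real.sq_sqrt hpos.le
  rw [← div_le_iff₀' hpos]
  refine le_inducedReg hK hC fun u z huz => ?_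
  rw [div_le_iff₀' hpos]
  have h := inducedReg_flipVec_circConv_le hC (√|γ| • u) ((γ / √|γ|) • z)
  rw [circConv_smul_smul, mul_div_cancel₀ _ (Real.sqrt_pos.2 hpos).ne'] at h
  have hγz : (γ / √|γ|) ^ 2 = |γ| := by
    rw [div_pow, hsq, ← sq_abs, sq, mul_div_cancel_right₀ _ hpos.ne']
  simp only [Pi.smul_apply, smul_eq_mul, mul_pow, hsq, hγz, ← Finset.mul_sum] at h
  rw [← huz, mul_add]
  exact h

theorem inducedReg_smul {K D C : ℕ} (hK : 1 ≤ K) (hC : 1 ≤ C) (γ : ℝ) (w : Fin D → ℝ) :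
    inducedReg K D C (γ • w) = |γ| * inducedReg K D C w := by
  rcases eq_or_ne γ 0 with rfl | hγ
  · simp [inducedReg_zero hC]
  · refine le_antisymm (inducedReg_smul_le hK hC hγ w) ?_
    have h := inducedReg_smul_le hK hC (inv_ne_zero hγ) (γ • w)
    rwa [inv_smul_smul₀ hγ, abs_inv, le_inv_mul_iff₀ (abs_pos.2 hγ)] at h

theorem inducedReg_eq_zero_iff {K D C : ℕ} (hK : 1 ≤ K) (hC : 1 ≤ C) (w : Fin D → ℝ) :
    inducedReg K D C w = 0 ↔ w = 0 := by
  refine ⟨fun h => funext fun d => ?_, fun h => h ▸ inducedReg_zero hC⟩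
  have hK' : (0 : ℝ) < K := by exact_mod_cast hK
  have hle : |w d| / K ≤ inducedReg K D C w := le_inducedReg hK hC fun u z huz => by
    rw [div_le_iff₀' hK', ← huz]
    exact abs_circConv_le u z _
  rw [h, div_le_iff₀ hK', zero_mul] at hle
  exact abs_nonpos_iff.1 hle

theorem inducedReg_add_le {K D C : ℕ} (hK : 1 ≤ K) (hC : 1 ≤ C) (w₁ w₂ : Fin D → ℝ) :
    inducedReg K D C (w₁ + w₂) ≤ inducedReg K D C w₁ + inducedReg K D C w₂ := by
  rw [← sub_le_iff_le_add]
  refine le_inducedReg hK hC fun u₁ z₁ h₁ => ?_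
  rw [sub_le_comm]
  refine le_inducedReg hK hC fun u₂ z₂ h₂ => ?_
  obtain ⟨u, z, h, hle⟩ := exists_circConv_eq_add hK u₁ u₂ z₁ z₂
  have hw : flipVec (circConv u z) = w₁ + w₂ := by
    rw [h, ← h₁, ← h₂]
    rfl
  have := inducedReg_flipVec_circConv_le hC u z
  rw [hw] at this
  linarith

/-- `w ↦ R_{K,C}(w)` is a norm on `ℝ^D`: nonnegative, definite, absolutely homogeneous,
and subadditive. -/
theorem induced_reg_is_norm (K D C : ℕ) (hK : 1 ≤ K) (hKD : K ≤ D) (hC : 1 ≤ C) :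
    (∀ w : Fin D → ℝ, 0 ≤ inducedReg K D C w) ∧
    (∀ w : Fin D → ℝ, inducedReg K D C w = 0 ↔ w = 0) ∧
    (∀ (γ : ℝ) (w : Fin D → ℝ), inducedReg K D C (γ • w) = |γ| * inducedReg K D C w) ∧
    (∀ w₁ w₂ : Fin D → ℝ,
      inducedReg K D C (w₁ + w₂) ≤ inducedReg K D C w₁ + inducedReg K D C w₂) := by
  exact ⟨inducedReg_nonneg, inducedReg_eq_zero_iff hK hC, inducedReg_smul hK hC,
    inducedReg_add_le hK hC⟩
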